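/- arXiv:1806.01928 — 2 statements merged into one kernel-verified Lean document; each statement's English description precedes it below -/
import Mathlib

section
/- Transfer of asymptotic equicontinuity (Lemma 4). Let (Ω, 𝓕, P) be a probability space, let (𝒰, d₁) and (ℱ, d₂) be pseudometric spaces, and let ρ be the product pseudometric on 𝒰 × ℱ given by ρ((u,f),(v,g)) := max(d₁(u,v), d₂(f,g)). For each n let Vₙ: Ω → (𝒰 × ℱ → ℝ) be a stochastic process, and assume asymptotic uniform ρ-equicontinuity: for every ε > 0 and η > 0 there exists δ > 0 such that limsup_n P{ω : sup over pairs (u,f), (v,g) with ρ((u,f),(v,g)) < δ of |Vₙ(ω)(u,f) − Vₙ(ω)(v,g)| > ε} < η. Let fₙ: Ω → ℱ be maps and f₀ ∈ ℱ with d₂(fₙ, f₀) → 0 in probability. Then sup_{u ∈ 𝒰} |Vₙ(u, fₙ) − Vₙ(u, f₀)| → 0 in probability. -/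
open MeasureTheory Filter Set

/-- **Lemma 4 (transfer of asymptotic uniform equicontinuity).**
If the processes `Vₙ` are asymptotically uniformly equicontinuous with respect to the
product pseudometric on `𝒰 × ℱ`, and `d₂(fₙ, f₀) → 0` in probability, then
`sup_{u ∈ 𝒰} |Vₙ(u, fₙ) − Vₙ(u, f₀)| → 0` in (outer) probability. -/
theorem transfer_asymptotic_equicontinuity
    {Ω : Type*} [MeasurableSpace Ω] (P : Measure Ω) [IsProbabilityMeasure P]
    {U F : Type*} [PseudoMetricSpace U] [PseudoMetricSpace F]
    (V : ℕ → Ω → U → F → ℝ)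
    (hequi : ∀ ε : ℝ, 0 < ε → ∀ η : ℝ, 0 < η → ∃ δ : ℝ, 0 < δ ∧
      limsup (fun n => P {ω | ∃ u v : U, ∃ f g : F,
        max (dist u v) (dist f g) < δ ∧ ε < |V n ω u f - V n ω v g|}) atTop
        < ENNReal.ofReal η)
    (fn : ℕ → Ω → F) (f₀ : F)
    (hfn : ∀ ε : ℝ, 0 < ε →
      Tendsto (fun n => P {ω | ε ≤ dist (fn n ω) f₀}) atTop (nhds 0)) :
    ∀ ε : ℝ, 0 < ε →
      Tendsto (fun n => P {ω | ∃ u : U, ε ≤ |V n ω u (fn n ω) - V n ω u f₀|})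
        atTop (nhds 0) := by
  intro ε hε
  rw [ENNReal.tendsto_nhds_zero]
  intro η hη
  obtain ⟨r, hr0, hrη⟩ := ENNReal.lt_iff_exists_nnreal_btwn.1 (ENNReal.half_pos hη.ne')
  have hr : (0 : ℝ) < r := by exact_mod_cast hr0
  obtain ⟨δ, hδ, hlim⟩ := hequi (ε / 2) (half_pos hε) r hr
  rw [ENNReal.ofReal_coe_nnreal] at hlim
  filter_upwards [eventually_lt_of_limsup_lt hlim,
    ENNReal.tendsto_nhds_zero.1 (hfn δ hδ) r hr0] with n hV hf
  refine (measure_mono ?_).trans ((measure_union_le _ _).trans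
    ((add_le_add (hV.le.trans hrη.le) (hf.trans hrη.le)).trans (ENNReal.add_halves η).le))
  rintro ω ⟨u, hu⟩
  by_cases h : δ ≤ dist (fn n ω) f₀
  · exact Or.inr h
  · refine Or.inl ⟨u, u, fn n ω, f₀, ?_, (half_lt_self hε).trans_le hu⟩
    rw [dist_self]
    exact max_lt hδ (not_le.1 h)
end

section
/- Local growth of the centered primitive (intermediate claim in the proof of Theorem 3). Let x ∈ ℝ, α > 0, π₀ ∈ [0,∞) and δ > 0. Let θ₀ be nondecreasing on (x−δ, x+δ) with lim_{u→0} |θ₀(x+u) − θ₀(x)|/|u|^α = π₀. Let Φ₀ be nondecreasing and differentiable on (x−δ, x+δ) with derivative Φ₀' continuous at x, and let Γ₀ be differentiable on (x−δ, x+δ) with Γ₀'(v) = θ₀(v)Φ₀'(v) for all v ∈ (x−δ, x+δ). Define M(u) := [Γ₀(x+u) − θ₀(x)Φ₀(x+u)] − [Γ₀(x) − θ₀(x)Φ₀(x)] for |u| < δ. Then lim_{u→0} M(u)/|u|^{α+1} = Φ₀'(x)π₀/(α+1). -/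
open Filter Set

/-- Away from the origin, `|u| ^ (α + 1)` has derivative `(α + 1) * |u| ^ α * sign u`. -/
lemma hasDerivAt_abs_rpow_add_one (α : ℝ) {u : ℝ} (hu : u ≠ 0) :
    HasDerivAt (fun u : ℝ => |u| ^ (α + 1)) ((α + 1) * |u| ^ α * (SignType.sign u : ℝ)) u := by
  have h := (hasDerivAt_abs hu).rpow_const (p := α + 1) (Or.inl (abs_ne_zero.mpr hu))
  rw [add_sub_cancel_right] at h
  exact h.congr_deriv (by ring)

/-- The increments of a monotone function have the sign of the increments of the variable. -/
lemma MonotoneOn.sub_eq_abs_mul_sign {f : ℝ → ℝ} {s : Set ℝ} (hf : MonotoneOn f s) {x u : ℝ}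
    (hx : x ∈ s) (hxu : x + u ∈ s) (hu : u ≠ 0) :
    f (x + u) - f x = |f (x + u) - f x| * (SignType.sign u : ℝ) := by
  rcases lt_or_gt_of_ne hu with h | h
  · have := hf hxu hx (by linarith)
    rw [abs_of_nonpos (by linarith), sign_neg h]
    simp
  · have := hf hx hxu (by linarith)
    rw [abs_of_nonneg (by linarith), sign_pos h]
    simp

/-- **Local growth of the centered primitive (from the proof of Theorem 3).** -/
theorem centered_primitive_local_growth
    (x α π₀ δ : ℝ) (hα : 0 < α) (hπ : 0 ≤ π₀) (hδ : 0 < δ)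
    (θ₀ Φ₀ Γ₀ dΦ₀ : ℝ → ℝ)
    (hθmono : MonotoneOn θ₀ (Ioo (x - δ) (x + δ)))
    (hθloc : Tendsto (fun u => |θ₀ (x + u) - θ₀ x| / |u| ^ α)
      (nhdsWithin 0 {(0:ℝ)}ᶜ) (nhds π₀))
    (hΦmono : MonotoneOn Φ₀ (Ioo (x - δ) (x + δ)))
    (hΦderiv : ∀ v ∈ Ioo (x - δ) (x + δ), HasDerivAt Φ₀ (dΦ₀ v) v)
    (hdcont : ContinuousAt dΦ₀ x)
    (hΓderiv : ∀ v ∈ Ioo (x - δ) (x + δ), HasDerivAt Γ₀ (θ₀ v * dΦ₀ v) v) :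
    Tendsto (fun u =>
        ((Γ₀ (x + u) - θ₀ x * Φ₀ (x + u)) - (Γ₀ x - θ₀ x * Φ₀ x)) / |u| ^ (α + 1))
      (nhdsWithin 0 {(0:ℝ)}ᶜ) (nhds (dΦ₀ x * π₀ / (α + 1))) := by
  have hα' : α + 1 ≠ 0 := by positivity
  have hsign {u : ℝ} (hu : u ≠ 0) : (SignType.sign u : ℝ) ≠ 0 := by
    rcases lt_or_gt_of_ne hu with h | h <;> simp [h]
  have hx : x ∈ Ioo (x - δ) (x + δ) := ⟨by linarith, by linarith⟩
  have hshift : Tendsto (fun u => x + u) (nhds 0) (nhds x) := by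
    simpa using (continuous_const_add x).tendsto 0
  have hne : ∀ᶠ u : ℝ in nhdsWithin 0 {(0:ℝ)}ᶜ, u ≠ 0 := self_mem_nhdsWithin
  have hmem : ∀ᶠ u : ℝ in nhdsWithin 0 {(0:ℝ)}ᶜ, x + u ∈ Ioo (x - δ) (x + δ) :=
    (hshift.eventually (isOpen_Ioo.mem_nhds hx)).filter_mono nhdsWithin_le_nhds
  have hM : ∀ u, x + u ∈ Ioo (x - δ) (x + δ) → HasDerivAt
      (fun u => (Γ₀ (x + u) - θ₀ x * Φ₀ (x + u)) - (Γ₀ x - θ₀ x * Φ₀ x))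
      ((θ₀ (x + u) - θ₀ x) * dΦ₀ (x + u)) u := by
    intro u hu
    have h := (((hΓderiv _ hu).comp_const_add x u).sub
      (((hΦderiv _ hu).comp_const_add x u).const_mul (θ₀ x))).sub_const
      (Γ₀ x - θ₀ x * Φ₀ x)
    exact h.congr_deriv (by ring)
  refine HasDerivAt.lhopital_zero_nhdsNE
    (f' := fun u => (θ₀ (x + u) - θ₀ x) * dΦ₀ (x + u))
    (g' := fun u => (α + 1) * |u| ^ α * (SignType.sign u : ℝ)) ?_ ?_ ?_ ?_ ?_ ?_
  · filter_upwards [hmem] with u hu using hM u hu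
  · filter_upwards [hne] with u hu using hasDerivAt_abs_rpow_add_one α hu
  · filter_upwards [hne] with u hu
    have : |u| ^ α ≠ 0 := (Real.rpow_pos_of_pos (abs_pos.mpr hu) α).ne'
    have := hsign hu
    positivity
  · have h := (hM 0 (by simpa using hx)).continuousAt.tendsto
    simp only [add_zero, sub_self] at h
    exact h.mono_left nhdsWithin_le_nhds
  · have h : ContinuousAt (fun u : ℝ => |u| ^ (α + 1)) 0 :=
      continuous_abs.continuousAt.rpow_const (Or.inr (by positivity))
    have h' := h.tendsto
    simp only [abs_zero, Real.zero_rpow hα'] at h'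
    exact h'.mono_left nhdsWithin_le_nhds
  · have hd : Tendsto (fun u => dΦ₀ (x + u)) (nhdsWithin 0 {(0:ℝ)}ᶜ) (nhds (dΦ₀ x)) :=
      (hdcont.tendsto.comp hshift).mono_left nhdsWithin_le_nhds
    refine ((hd.mul hθloc).div_const (α + 1)).congr' ?_
    filter_upwards [hne, hmem] with u hu hxu
    have : |u| ^ α ≠ 0 := (Real.rpow_pos_of_pos (abs_pos.mpr hu) α).ne'
    have := hsign hu
    nth_rw 2 [hθmono.sub_eq_abs_mul_sign hx hxu hu]
    field_simp
end
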